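/- Let T > 0, θ ∈ (0,1], C_T > 0, let f ∈ L^1([0,T]) be nonnegative, and let y : [0,T] → [0, ∞) be measurable. Let t₀ ∈ (0,T] be such that y(τ) ≤ 1/2 for all τ ∈ [0,t₀] and ∫₀^{t₀} f(t) dt < θ/4. Assume that for every m > 2 and every τ ∈ [0,t₀]: y(τ) ≤ C_T · m^{−θ} + ∫₀^τ f(t) · y(t) · ( |log y(t)| + log((1+m)e) ) dt (with the convention that the integrand is 0 where y(t) = 0). Then y(τ) = 0 for every τ ∈ [0,t₀]. -/

import Mathlib

open MeasureTheory Real Set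
open scoped ENNReal BigOperators

/-- A Lipschitz function composed with an absolutely continuous function is absolutely
continuous. -/
theorem LipschitzOnWith.comp_absolutelyContinuousOnInterval {X Y : Type*} [PseudoMetricSpace X]
    [PseudoMetricSpace Y] {φ : X → Y} {K : NNReal} {s : Set X} {h : ℝ → X} {a b : ℝ}
    (hφ : LipschitzOnWith K φ s) (hh : AbsolutelyContinuousOnInterval h a b)
    (hs : MapsTo h (uIcc a b) s) : AbsolutelyContinuousOnInterval (φ ∘ h) a b := by
  rw [absolutelyContinuousOnInterval_iff] at hh ⊢
  intro ε hε
  obtain ⟨δ, hδ, H⟩ := hh (ε / (K + 1)) (by positivity)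
  refine ⟨δ, hδ, fun E hE hlen ↦ ?_⟩
  calc ∑ i ∈ Finset.range E.1, dist ((φ ∘ h) (E.2 i).1) ((φ ∘ h) (E.2 i).2)
      ≤ ∑ i ∈ Finset.range E.1, K * dist (h (E.2 i).1) (h (E.2 i).2) :=
        Finset.sum_le_sum fun i hi ↦
          hφ.dist_le_mul _ (hs (hE.1 i hi).1) _ (hs (hE.1 i hi).2)
    _ = K * ∑ i ∈ Finset.range E.1, dist (h (E.2 i).1) (h (E.2 i).2) :=
        (Finset.mul_sum _ _ _).symm
    _ ≤ K * (ε / (K + 1)) := by gcongr; exact (H E hE hlen).le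
    _ < (K + 1) * (ε / (K + 1)) := by gcongr; linarith
    _ = ε := by field

/-- **Grönwall's inequality** in integral form, with an integrable coefficient `g`. -/
theorem le_mul_exp_integral_of_le_add_integral {g u : ℝ → ℝ} {A a b : ℝ} (hab : a ≤ b)
    (hg : IntervalIntegrable g volume a b) (hg0 : ∀ t ∈ Icc a b, 0 ≤ g t)
    (hgu : IntervalIntegrable (fun t ↦ g t * u t) volume a b)
    (hu : ∀ t ∈ Icc a b, u t ≤ A + ∫ s in a..t, g s * u s) :
    u b ≤ A * exp (∫ t in a..b, g t) := by
  set V : ℝ → ℝ := fun x ↦ A + ∫ s in a..x, g s * u s with hV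
  set G : ℝ → ℝ := fun x ↦ ∫ s in a..x, g s with hG
  set E : ℝ → ℝ := (fun r ↦ exp (-r)) ∘ G with hE
  have hI := uIcc_of_le hab
  have ha : a ∈ uIcc a b := left_mem_uIcc
  have hVac : AbsolutelyContinuousOnInterval V a b :=
    (contDiffOn_const (c := A)).absolutelyContinuousOnInterval.fun_add
      (hgu.absolutelyContinuousOnInterval_intervalIntegral ha)
  have hGac : AbsolutelyContinuousOnInterval G a b :=
    hg.absolutelyContinuousOnInterval_intervalIntegral ha
  have hEac : AbsolutelyContinuousOnInterval E a b := by
    obtain ⟨C, hC⟩ := hGac.exists_bound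
    obtain ⟨K, hK⟩ := ContDiffOn.exists_lipschitzOnWith (s := Icc (-C) C)
      (f := fun r : ℝ ↦ exp (-r)) (n := 1) (by fun_prop) (by decide) (convex_Icc _ _)
      isCompact_Icc
    exact hK.comp_absolutelyContinuousOnInterval hGac fun x hx ↦ abs_le.mp (hC x hx)
  have hFTC := hVac.integral_deriv_mul_eq_sub hEac
  have hle : ∫ x in a..b, deriv V x * E x + V x * deriv E x ≤ 0 := by
    rw [← neg_nonneg, ← intervalIntegral.integral_neg]
    refine intervalIntegral.integral_nonneg_of_ae_restrict hab ?_
    refine (ae_restrict_iff' measurableSet_Icc).mpr ?_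
    filter_upwards [hg.ae_hasDerivAt_integral, hgu.ae_hasDerivAt_integral] with x h1 h2 hx
    have hG' : HasDerivAt G (g x) x := h1 (hI ▸ hx) a ha
    have hV' : HasDerivAt V (g x * u x) x := (h2 (hI ▸ hx) a ha).const_add A
    have hE' : HasDerivAt E (exp (-G x) * -g x) x := hG'.neg.exp
    rw [hV'.deriv, hE'.deriv]
    have : 0 ≤ exp (-G x) * (g x * (V x - u x)) :=
      mul_nonneg (exp_pos _).le (mul_nonneg (hg0 x hx) (sub_nonneg.mpr (hu x hx)))
    simp only [hE, Function.comp_apply, Pi.zero_apply]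
    linarith
  have hVE : V b * exp (-G b) ≤ A := by
    have h1 : V a * E a = A := by simp [hV, hE, hG]
    have h2 : V b * E b = V b * exp (-G b) := rfl
    linarith
  calc u b ≤ V b := hu b ⟨hab, le_rfl⟩
    _ = V b * exp (-G b) * exp (G b) := by rw [mul_assoc, ← exp_add]; simp
    _ ≤ A * exp (G b) := by gcongr

/-- The logarithmic nonlinearity is dominated by a linear function of `r + m⁻¹`. -/
theorem mul_abs_log_add_log_le {m r : ℝ} (hm : 2 < m) (hr : 0 ≤ r) (hr1 : r ≤ 1) :
    r * (|log r| + log ((1 + m) * exp 1)) ≤ 3 * log m * (r + m⁻¹) := by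
  have hm0 : 0 < m := by linarith
  have hK : log m + log (1 + m) ≤ 3 * log m := by
    have : log (1 + m) ≤ log (m ^ 2) := log_le_log (by linarith) (by nlinarith)
    rw [log_pow] at this
    push_cast at this
    linarith
  have hlogm : 1 ≤ 3 * log m := by
    have := log_two_gt_d9
    have := log_le_log two_pos hm.le
    linarith
  have hL : log ((1 + m) * exp 1) = log (1 + m) + 1 := by
    rw [log_mul (by linarith) (exp_pos 1).ne', log_exp]
  have hneg : r * |log r| ≤ r * log m + m⁻¹ - r := by
    rcases hr.eq_or_lt with rfl | hr0
    · simpa using hm0.le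
    have h := log_le_sub_one_of_pos (inv_pos.mpr (mul_pos hm0 hr0))
    rw [log_inv, log_mul hm0.ne' hr0.ne'] at h
    have h2 := mul_le_mul_of_nonneg_left h hr
    have h3 : r * ((m * r)⁻¹ - 1) = m⁻¹ - r := by field
    rw [abs_of_nonpos (log_nonpos hr hr1)]
    linarith
  have hrK := mul_le_mul_of_nonneg_left hK hr
  have hmK := mul_le_mul_of_nonneg_right hlogm (inv_pos.mpr hm0).le
  rw [hL]
  linarith

/-- **Logarithmic Grönwall-type lemma** (Step 2 of the proof of weak-strong uniqueness):
let `θ ∈ (0,1]`, `C_T > 0`, `f ∈ L¹([0,T])` nonnegative and `y : [0,T] → [0,∞)` measurable.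
Let `t₀ ∈ (0,T]` be such that `y ≤ 1/2` on `[0,t₀]` and `∫₀^{t₀} f < θ/4`.  If for every
`m > 2` and every `τ ∈ [0,t₀]`
`y(τ) ≤ C_T m^{-θ} + ∫₀^τ f(t) y(t) (|log y(t)| + log((1+m)e)) dt`
(the integrand vanishes where `y(t) = 0`, consistently with `log 0 = 0`),
then `y ≡ 0` on `[0,t₀]`. -/
theorem log_gronwall (T θ C_T : ℝ) (hT : 0 < T) (hθ : θ ∈ Set.Ioc (0 : ℝ) 1) (hCT : 0 < C_T)
    (f : ℝ → ℝ) (hf_int : IntegrableOn f (Set.Icc 0 T))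
    (hf_nonneg : ∀ t ∈ Set.Icc (0 : ℝ) T, 0 ≤ f t)
    (y : ℝ → ℝ) (hy_meas : Measurable y) (hy_nonneg : ∀ t, 0 ≤ y t)
    (t₀ : ℝ) (ht₀ : t₀ ∈ Set.Ioc 0 T)
    (hsmall : ∀ τ ∈ Set.Icc 0 t₀, y τ ≤ 1 / 2)
    (hfsmall : ∫ t in Set.Ioc (0 : ℝ) t₀, f t < θ / 4)
    (hmain : ∀ m : ℝ, 2 < m → ∀ τ ∈ Set.Icc 0 t₀,
      y τ ≤ C_T * m ^ (-θ)
        + ∫ t in Set.Ioc 0 τ, f t * y t * (|Real.log (y t)| + Real.log ((1 + m) * Real.exp 1))) :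
    ∀ τ ∈ Set.Icc 0 t₀, y τ = 0 := by
  intro τ hτ
  obtain ⟨hθ0, hθ1⟩ := hθ
  have hτT : τ ≤ T := hτ.2.trans ht₀.2
  have hsub : Icc 0 τ ⊆ Icc 0 T := Icc_subset_Icc_right hτT
  have hfτ : IntegrableOn f (Icc 0 τ) := hf_int.mono_set hsub
  have hFτ : ∫ t in (0 : ℝ)..τ, f t ≤ θ / 4 := by
    rw [intervalIntegral.integral_of_le hτ.1]
    refine (setIntegral_mono_set ?_ ?_ ?_).trans hfsmall.le
    · exact hf_int.mono_set (Ioc_subset_Icc_self.trans (Icc_subset_Icc_right ht₀.2))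
    · exact (ae_restrict_iff' measurableSet_Ioc).mpr <| ae_of_all _ fun t ht ↦
        hf_nonneg t ⟨ht.1.le, ht.2.trans ht₀.2⟩
    · exact (Ioc_subset_Ioc_right hτ.2).eventuallyLE
  have hbound : ∀ m : ℝ, 2 < m → y τ ≤ (C_T + 1) * m ^ (-(θ / 4)) := by
    intro m hm
    have hm0 : 0 < m := by linarith
    have hlogm : 0 ≤ log m := log_nonneg (by linarith)
    have hgu : IntegrableOn (fun t ↦ 3 * log m * f t * (y t + m⁻¹)) (Icc 0 τ) := by
      refine (hfτ.const_mul (3 * log m)).mul_bdd (c := 1 / 2 + m⁻¹)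
        (hy_meas.add_const _).aestronglyMeasurable ?_
      refine (ae_restrict_iff' measurableSet_Icc).mpr <| ae_of_all _ fun t ht ↦ ?_
      rw [norm_of_nonneg (add_nonneg (hy_nonneg t) (inv_pos.mpr hm0).le)]
      gcongr
      exact hsmall t ⟨ht.1, ht.2.trans hτ.2⟩
    have key := le_mul_exp_integral_of_le_add_integral (g := fun t ↦ 3 * log m * f t)
      (u := fun t ↦ y t + m⁻¹) (A := C_T * m ^ (-θ) + m⁻¹) hτ.1
      ((intervalIntegrable_iff_integrableOn_Icc_of_le hτ.1).mpr (hfτ.const_mul _))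
      (fun t ht ↦ mul_nonneg (by positivity) (hf_nonneg t (hsub ht)))
      ((intervalIntegrable_iff_integrableOn_Icc_of_le hτ.1).mpr hgu) ?_
    · rw [intervalIntegral.integral_const_mul] at key
      have hinv : m⁻¹ ≤ m ^ (-θ) := by
        rw [← rpow_neg_one]
        exact rpow_le_rpow_of_exponent_le (by linarith) (by linarith)
      have hexp : exp (3 * log m * ∫ t in (0 : ℝ)..τ, f t) ≤ m ^ (3 * (θ / 4)) := by
        rw [rpow_def_of_pos hm0, exp_le_exp]
        nlinarith
      calc y τ ≤ y τ + m⁻¹ := le_add_of_nonneg_right (inv_pos.mpr hm0).le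
        _ ≤ (C_T * m ^ (-θ) + m⁻¹) * exp (3 * log m * ∫ t in (0 : ℝ)..τ, f t) := key
        _ ≤ (C_T * m ^ (-θ) + m ^ (-θ)) * m ^ (3 * (θ / 4)) := by gcongr
        _ = (C_T + 1) * (m ^ (-θ) * m ^ (3 * (θ / 4))) := by ring
        _ = (C_T + 1) * m ^ (-(θ / 4)) := by rw [← rpow_add hm0]; ring_nf
    · intro t ht
      have hmono : ∫ s in Ioc 0 t, f s * y s * (|log (y s)| + log ((1 + m) * exp 1))
          ≤ ∫ s in Ioc 0 t, 3 * log m * f s * (y s + m⁻¹) := by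
        have hlog : 0 ≤ log ((1 + m) * exp 1) :=
          log_nonneg (one_le_mul_of_one_le_of_one_le (by linarith) (one_le_exp zero_le_one))
        have hmem : ∀ s ∈ Ioc 0 t, s ∈ Icc 0 τ := fun s hs ↦ ⟨hs.1.le, hs.2.trans ht.2⟩
        refine integral_mono_of_nonneg ?_ (hgu.mono_set hmem) ?_ <;>
          refine (ae_restrict_iff' measurableSet_Ioc).mpr <| ae_of_all _ fun s hs ↦ ?_
        · have := hf_nonneg s (hsub (hmem s hs))
          have := hy_nonneg s
          simp only [Pi.zero_apply]
          positivity
        · have hy1 : y s ≤ 1 :=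
            (hsmall s ⟨hs.1.le, hs.2.trans (ht.2.trans hτ.2)⟩).trans (by norm_num)
          have := mul_le_mul_of_nonneg_left (mul_abs_log_add_log_le hm (hy_nonneg s) hy1)
            (hf_nonneg s (hsub (hmem s hs)))
          dsimp only
          linarith
      rw [intervalIntegral.integral_of_le ht.1]
      linarith [hmain m hm t ⟨ht.1, ht.2.trans hτ.2⟩]
  have hlim : Filter.Tendsto (fun m : ℝ ↦ (C_T + 1) * m ^ (-(θ / 4))) Filter.atTop (nhds 0) := by
    simpa using (tendsto_rpow_neg_atTop (by positivity : 0 < θ / 4)).const_mul (C_T + 1)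
  refine le_antisymm (ge_of_tendsto hlim ?_) (hy_nonneg τ)
  filter_upwards [Filter.eventually_gt_atTop 2] with m hm using hbound m hm
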